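/- Let T > 0, d ∈ ℕ, let x : [0,T] → ℝ^d be continuous, and let f : [0,T] × ℝ^d → ℝ be continuous such that the partial derivative ∂_t f exists and is jointly continuous on [0,T] × ℝ^d. Then for every ε > 0 there exists δ > 0 such that for every partition 0 = t_0 < ⋯ < t_n = T of [0,T] with mesh < δ one has | Σ_{k=0}^{n−1} ( f(t_{k+1}, x_{t_{k+1}}) − f(t_k, x_{t_{k+1}}) ) − ∫_0^T ∂_t f(u, x_u) du | < ε. -/

import Mathlib

theorem Fin.sum_succ_sub_castSucc {G : Type*} [AddCommGroup G] {n : ℕ} (F : Fin (n + 1) → G) :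
    ∑ k : Fin n, (F k.succ - F k.castSucc) = F (Fin.last n) - F 0 := by
  rw [Finset.sum_sub_distrib, sub_eq_sub_iff_add_eq_add, add_comm _ (F 0), ← Fin.sum_univ_succ,
    Fin.sum_univ_castSucc, add_comm]

/-- If the time derivative of `F` on `[a, b]` stays within `C` of `g`, then the increment of `F`
is within `C * (b - a)` of the integral of `g`. -/
theorem abs_sub_sub_integral_le {F F' g : ℝ → ℝ} {a b C : ℝ} (hab : a ≤ b)
    (hF : ∀ t ∈ Set.Icc a b, HasDerivAt F (F' t) t) (hF' : ContinuousOn F' (Set.Icc a b))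
    (hg : ContinuousOn g (Set.Icc a b)) (hC : ∀ t ∈ Set.Icc a b, |F' t - g t| ≤ C) :
    |F b - F a - ∫ t in a..b, g t| ≤ C * (b - a) := by
  have hF'i : IntervalIntegrable F' MeasureTheory.volume a b :=
    hF'.intervalIntegrable_of_Icc hab
  have hgi : IntervalIntegrable g MeasureTheory.volume a b := hg.intervalIntegrable_of_Icc hab
  rw [← intervalIntegral.integral_eq_sub_of_hasDerivAt
    (fun t ht => hF t (by rwa [Set.uIcc_of_le hab] at ht)) hF'i,
    ← intervalIntegral.integral_sub hF'i hgi, ← abs_of_nonneg (sub_nonneg.2 hab)]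
  refine intervalIntegral.norm_integral_le_of_norm_le_const (f := fun t => F' t - g t)
    fun t ht => ?_
  rw [Set.uIoc_of_le hab] at ht
  exact hC t (Set.Ioc_subset_Icc_self ht)

/-- Let `x : [0,T] → ℝ^d` be continuous and let `f : [0,T] × ℝ^d → ℝ` be continuous with a
jointly continuous time derivative `ft = ∂_t f`.  Then the sums
`Σ_k ( f(t_{k+1}, x_{t_{k+1}}) - f(t_k, x_{t_{k+1}}) )` over partitions of `[0,T]` converge
to `∫_0^T ∂_t f(u, x_u) du` as the mesh tends to `0`. -/
theorem stmt_13 (T : ℝ) (hT : 0 < T) (d : ℕ)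
    (x : ℝ → EuclideanSpace ℝ (Fin d))
    (hxc : ContinuousOn x (Set.Icc 0 T))
    (f ft : ℝ → EuclideanSpace ℝ (Fin d) → ℝ)
    (hfc : ContinuousOn (fun q : ℝ × EuclideanSpace ℝ (Fin d) => f q.1 q.2)
      (Set.Icc 0 T ×ˢ Set.univ))
    (hft : ∀ t ∈ Set.Icc (0 : ℝ) T, ∀ y, HasDerivAt (fun s => f s y) (ft t y) t)
    (hftc : ContinuousOn (fun q : ℝ × EuclideanSpace ℝ (Fin d) => ft q.1 q.2)
      (Set.Icc 0 T ×ˢ Set.univ)) :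
    ∀ ε > 0, ∃ δ > 0, ∀ (n : ℕ) (π : Fin (n + 1) → ℝ), StrictMono π → π 0 = 0 →
      π (Fin.last n) = T → (∀ k : Fin n, π k.succ - π k.castSucc < δ) →
      |(∑ k : Fin n, (f (π k.succ) (x (π k.succ)) - f (π k.castSucc) (x (π k.succ))))
          - ∫ u in (0 : ℝ)..T, ft u (x u)| < ε := by
  intro ε hε
  have hG : ContinuousOn (fun p : ℝ × ℝ => ft p.1 (x p.2)) (Set.Icc 0 T ×ˢ Set.Icc 0 T) :=
    hftc.comp (continuousOn_fst.prodMk (hxc.comp continuousOn_snd fun _ hp => hp.2))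
      fun _ hp => ⟨hp.1, Set.mem_univ _⟩
  have hg : ContinuousOn (fun u => ft u (x u)) (Set.Icc 0 T) :=
    hG.comp (continuousOn_id.prodMk continuousOn_id) fun _ hu => ⟨hu, hu⟩
  obtain ⟨δ, hδ, hGδ⟩ := Metric.uniformContinuousOn_iff.1
    ((isCompact_Icc.prod isCompact_Icc).uniformContinuousOn_of_continuous hG)
    (ε / (2 * T)) (by positivity)
  refine ⟨δ, hδ, fun n π hπ h0 hlast hmesh => ?_⟩
  have hmem (j : Fin (n + 1)) : π j ∈ Set.Icc 0 T :=
    ⟨h0 ▸ hπ.monotone (Fin.zero_le j), hlast ▸ hπ.monotone (Fin.le_last j)⟩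
  have hint (a b : ℝ) (ha : a ∈ Set.Icc 0 T) (hb : b ∈ Set.Icc 0 T) :
      IntervalIntegrable (fun u => ft u (x u)) MeasureTheory.volume a b :=
    (hg.mono (Set.uIcc_subset_Icc ha hb)).intervalIntegrable
  have h0mem : (0 : ℝ) ∈ Set.Icc 0 T := ⟨le_rfl, hT.le⟩
  have hsplit : ∫ u in (0 : ℝ)..T, ft u (x u) =
      ∑ k : Fin n, ∫ u in π k.castSucc..π k.succ, ft u (x u) := by
    have h := Fin.sum_succ_sub_castSucc fun j => ∫ u in (0 : ℝ)..π j, ft u (x u)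
    simp only [h0, hlast, intervalIntegral.integral_same, sub_zero] at h
    rw [← h]
    exact Finset.sum_congr rfl fun k _ => intervalIntegral.integral_interval_sub_left
      (hint _ _ h0mem (hmem _)) (hint _ _ h0mem (hmem _))
  have hterm (k : Fin n) :
      |f (π k.succ) (x (π k.succ)) - f (π k.castSucc) (x (π k.succ))
          - ∫ u in π k.castSucc..π k.succ, ft u (x u)|
        ≤ ε / (2 * T) * (π k.succ - π k.castSucc) := by
    have hsub : Set.Icc (π k.castSucc) (π k.succ) ⊆ Set.Icc 0 T :=
      Set.Icc_subset_Icc (hmem _).1 (hmem _).2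
    refine abs_sub_sub_integral_le (F := fun s => f s (x (π k.succ)))
      (hπ.monotone (Fin.castSucc_lt_succ).le)
      (fun t ht => hft t (hsub ht) _) ?_ (hg.mono hsub) fun t ht => ?_
    · exact hG.comp (continuousOn_id.prodMk continuousOn_const) fun t ht => ⟨hsub ht, hmem _⟩
    · refine (hGδ (t, π k.succ) ⟨hsub ht, hmem _⟩ (t, t) ⟨hsub ht, hsub ht⟩ ?_).le
      rw [dist_prod_same_left, Real.dist_eq, abs_of_nonneg (sub_nonneg.2 ht.2)]
      exact (sub_le_sub_left ht.1 _).trans_lt (hmesh k)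
  rw [hsplit, ← Finset.sum_sub_distrib]
  calc _ ≤ ∑ k : Fin n, ε / (2 * T) * (π k.succ - π k.castSucc) :=
        (Finset.abs_sum_le_sum_abs _ _).trans (Finset.sum_le_sum fun k _ => hterm k)
    _ = ε / 2 := by
        rw [← Finset.mul_sum, Fin.sum_succ_sub_castSucc, h0, hlast]
        field_simp
        ring
    _ < ε := half_lt_self hε
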